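/- arXiv:2605.24393 — 2 statements merged into one kernel-verified Lean document; each statement's English description precedes it below -/
import Mathlib

section
/- Let A_s ∈ ℝ^{n_s×n_s}, A_u ∈ ℝ^{n_u×n_u} with A_u invertible, B_s ∈ ℝ^{n_s×p}, B_u ∈ ℝ^{n_u×p}, B_{s,w} ∈ ℝ^{n_s×l}, B_{u,w} ∈ ℝ^{n_u×l}, C_s ∈ ℝ^{m×n_s}, C_u ∈ ℝ^{m×n_u}, D ∈ ℝ^{m×p}. Let x_s : ℤ → ℝ^{n_s}, x_u : ℤ → ℝ^{n_u}, u : ℤ → ℝ^p, w : ℤ → ℝ^l, v, y : ℤ → ℝ^m be sequences satisfying x_s(k+1) = A_s x_s(k) + B_s u(k) + B_{s,w} w(k), x_u(k+1) = A_u x_u(k) + B_u u(k) + B_{u,w} w(k), and y(k) = C_s x_s(k) + C_u x_u(k) + D u(k) + v(k) for all k. Define H_i = C_s A_s^{i−1} B_s for i ≥ 1, H_0 = D − C_u A_u^{-1} B_u, H_{-j} = −C_u A_u^{-j-1} B_u for j ≥ 1, and F_i = C_s A_s^{i−1} B_{s,w} for i ≥ 1, F_0 = −C_u A_u^{-1}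 B_{u,w}, F_{-j} = −C_u A_u^{-j-1} B_{u,w} for j ≥ 1. Then for all k ∈ ℤ and all integers r ≥ 0, d ≥ 0: y(k) = Σ_{i=−d}^{r} H_i u(k−i) + Σ_{i=−d}^{r} F_i w(k−i) + C_s A_s^{r} x_s(k−r) + C_u A_u^{-d-1} x_u(k+d+1) + v(k). -/
open Matrix

theorem Finset.sum_Icc_neg_natCast_natCast {M : Type*} [AddCommMonoid M] (f : ℤ → M) (r d : ℕ) :
    ∑ i ∈ Finset.Icc (-(d : ℤ)) (r : ℤ), f i =
      f 0 + ∑ i ∈ Finset.range r, f ((i : ℤ) + 1) + ∑ j ∈ Finset.range d, f (-((j : ℤ) + 1)) := by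
  induction d with
  | zero =>
    induction r with
    | zero => simp
    | succ r ih =>
      have h : Finset.Icc (-((0 : ℕ) : ℤ)) ((r + 1 : ℕ) : ℤ) =
          insert ((r : ℤ) + 1) (Finset.Icc (-((0 : ℕ) : ℤ)) (r : ℤ)) := by
        ext i; simp only [Finset.mem_Icc, Finset.mem_insert]; lia
      rw [h, Finset.sum_insert (by simp), ih, Finset.sum_range_succ]
      abel
  | succ d ih =>
    have h : Finset.Icc (-((d + 1 : ℕ) : ℤ)) (r : ℤ) =
        insert (-((d : ℤ) + 1)) (Finset.Icc (-(d : ℤ)) (r : ℤ)) := by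
      ext i; simp only [Finset.mem_Icc, Finset.mem_insert]; lia
    rw [h, Finset.sum_insert (by simp), ih, Finset.sum_range_succ _ d]
    abel

section AffineRecursion

variable {n R : Type*} [Fintype n] [DecidableEq n] [CommRing R] {A : Matrix n n R} {x g : ℤ → n → R}

theorem Matrix.affine_recursion_unroll_backward (hx : ∀ k, x (k + 1) = A *ᵥ x k + g k)
    (k : ℤ) (r : ℕ) :
    x k = A ^ r *ᵥ x (k - r) + ∑ i ∈ Finset.range r, A ^ i *ᵥ g (k - (i + 1)) := by
  induction r with
  | zero => simp
  | succ r ih =>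
    have h : x (k - r) = A *ᵥ x (k - (r + 1)) + g (k - (r + 1)) := by
      rw [← hx]; congr 1; ring
    rw [Finset.sum_range_succ, ih, h, mulVec_add, mulVec_mulVec, ← pow_succ]
    push_cast
    abel

theorem Matrix.affine_recursion_unroll_forward (hA : IsUnit A.det)
    (hx : ∀ k, x (k + 1) = A *ᵥ x k + g k) (k : ℤ) (d : ℕ) :
    x k = A⁻¹ ^ d *ᵥ x (k + d) - ∑ j ∈ Finset.range d, A⁻¹ ^ (j + 1) *ᵥ g (k + j) := by
  induction d with
  | zero => simp
  | succ d ih =>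
    have h : x (k + d) = A⁻¹ *ᵥ x (k + (d + 1)) - A⁻¹ *ᵥ g (k + d) := by
      rw [← add_assoc, hx, mulVec_add, mulVec_mulVec, nonsing_inv_mul A hA, one_mulVec,
        add_sub_cancel_right]
    rw [Finset.sum_range_succ, ih, h, mulVec_sub, mulVec_mulVec, mulVec_mulVec, ← pow_succ]
    push_cast
    abel

end AffineRecursion

/-- **Exact truncated non-causal FIR (Laurent) representation of the output.**
For the stable/unstable-decoupled state-space system
`x_s(k+1) = A_s x_s(k) + B_s u(k) + B_{s,w} w(k)`,
`x_u(k+1) = A_u x_u(k) + B_u u(k) + B_{u,w} w(k)`,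
`y(k) = C_s x_s(k) + C_u x_u(k) + D u(k) + v(k)`,
with Markov parameters `H_i` (input-to-output) and `F_i` (noise-to-output) given by
`H_i = C_s A_s^(i-1) B_s` for `i ≥ 1`, `H_0 = D - C_u A_u⁻¹ B_u`,
`H_{-j} = -C_u A_u^(-j-1) B_u` for `j ≥ 1` (here `A_u^(-j-1) = (A_u⁻¹)^(j+1)`), and
analogously for `F` with `B_{s,w}, B_{u,w}` (but `F_0 = -C_u A_u⁻¹ B_{u,w}`),
one has, for all `k ∈ ℤ` and horizons `r, d ≥ 0`,
`y(k) = ∑_{i=-d}^{r} H_i u(k-i) + ∑_{i=-d}^{r} F_i w(k-i)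
        + C_s A_s^r x_s(k-r) + C_u A_u^{-(d+1)} x_u(k+d+1) + v(k)`. -/
theorem truncated_noncausal_fir_representation {ns nu m p l : ℕ}
    (As : Matrix (Fin ns) (Fin ns) ℝ) (Au : Matrix (Fin nu) (Fin nu) ℝ)
    (hAu : IsUnit Au.det)
    (Bs : Matrix (Fin ns) (Fin p) ℝ) (Bu : Matrix (Fin nu) (Fin p) ℝ)
    (Bsw : Matrix (Fin ns) (Fin l) ℝ) (Buw : Matrix (Fin nu) (Fin l) ℝ)
    (Cs : Matrix (Fin m) (Fin ns) ℝ) (Cu : Matrix (Fin m) (Fin nu) ℝ)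
    (D : Matrix (Fin m) (Fin p) ℝ)
    (xs : ℤ → Fin ns → ℝ) (xu : ℤ → Fin nu → ℝ)
    (u : ℤ → Fin p → ℝ) (w : ℤ → Fin l → ℝ) (v y : ℤ → Fin m → ℝ)
    (hxs : ∀ k : ℤ, xs (k + 1) = As.mulVec (xs k) + Bs.mulVec (u k) + Bsw.mulVec (w k))
    (hxu : ∀ k : ℤ, xu (k + 1) = Au.mulVec (xu k) + Bu.mulVec (u k) + Buw.mulVec (w k))
    (hy : ∀ k : ℤ, y k = Cs.mulVec (xs k) + Cu.mulVec (xu k) + D.mulVec (u k) + v k)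
    (H : ℤ → Matrix (Fin m) (Fin p) ℝ) (F : ℤ → Matrix (Fin m) (Fin l) ℝ)
    (hHpos : ∀ i : ℕ, H ((i : ℤ) + 1) = Cs * As ^ i * Bs)
    (hH0 : H 0 = D - Cu * Au⁻¹ * Bu)
    (hHneg : ∀ j : ℕ, H (-((j : ℤ) + 1)) = -(Cu * (Au⁻¹) ^ (j + 2) * Bu))
    (hFpos : ∀ i : ℕ, F ((i : ℤ) + 1) = Cs * As ^ i * Bsw)
    (hF0 : F 0 = -(Cu * Au⁻¹ * Buw))
    (hFneg : ∀ j : ℕ, F (-((j : ℤ) + 1)) = -(Cu * (Au⁻¹) ^ (j + 2) * Buw)) :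
    ∀ (k : ℤ) (r d : ℕ),
      y k = (∑ i ∈ Finset.Icc (-(d : ℤ)) (r : ℤ), (H i).mulVec (u (k - i)))
          + (∑ i ∈ Finset.Icc (-(d : ℤ)) (r : ℤ), (F i).mulVec (w (k - i)))
          + (Cs * As ^ r).mulVec (xs (k - r))
          + (Cu * (Au⁻¹) ^ (d + 1)).mulVec (xu (k + d + 1))
          + v k := by
  intro k r d
  have hs := congrArg (Cs *ᵥ ·) (affine_recursion_unroll_backward (x := xs) (A := As)
    (g := fun k ↦ Bs *ᵥ u k + Bsw *ᵥ w k) (fun k ↦ by rw [hxs, add_assoc]) k r)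
  have hu := congrArg (Cu *ᵥ ·) (affine_recursion_unroll_forward (x := xu) hAu
    (g := fun k ↦ Bu *ᵥ u k + Buw *ᵥ w k) (fun k ↦ by rw [hxu, add_assoc]) k (d + 1))
  simp only [Finset.sum_range_succ', mulVec_add, mulVec_sub, mulVec_sum, mulVec_mulVec,
    Finset.sum_add_distrib, ← Matrix.mul_assoc] at hs hu
  simp only [Finset.sum_Icc_neg_natCast_natCast, hHpos, hH0, hHneg, hFpos, hF0, hFneg,
    sub_mulVec, neg_mulVec, Finset.sum_neg_distrib, sub_neg_eq_add]
  rw [hy, hs, hu]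
  push_cast
  simp only [add_assoc, Nat.reduceAdd, pow_one, add_zero, sub_zero]
  abel
end

section
/- Let S_{k−1} be an invertible q×q real matrix, φ, z ∈ ℝ^q, y ∈ ℝ^m, λ ≠ 0 a real scalar with δ := λ + z^⊤ S_{k−1}^{-1} φ ≠ 0, and let M_{k−1} ∈ ℝ^{m×q}. Define S_k = λ S_{k−1} + φ z^⊤, M_k = λ M_{k−1} + y z^⊤, θ_{k−1} = M_{k−1} S_{k−1}^{-1}, and h^⊤ = z^⊤ S_{k−1}^{-1} / δ. Then S_k is invertible and θ_k := M_k S_k^{-1} satisfies the recursive update θ_k = θ_{k−1} + (y − θ_{k−1} φ) h^⊤. -/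
open Matrix

/-- The gain row vector maps the updated instrument matrix to the instrument. -/
theorem gain_vecMul_update {n K : Type*} [Fintype n] [DecidableEq n] [Field K]
    {S : Matrix n n K} (hS : IsUnit S.det) (φ z : n → K) {c : K}
    (hδ : c + z ⬝ᵥ S⁻¹ *ᵥ φ ≠ 0) :
    ((1 / (c + z ⬝ᵥ S⁻¹ *ᵥ φ)) • (z ᵥ* S⁻¹)) ᵥ* (c • S + vecMulVec φ z) = z := by
  rw [smul_vecMul, vecMul_add, vecMul_smul, vecMul_vecMul, nonsing_inv_mul _ hS, vecMul_one,
    vecMul_vecMulVec, ← dotProduct_mulVec, ← add_smul, smul_smul, one_div_mul_cancel hδ, one_smul]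

/-- The recursively updated estimate solves the updated instrumental-variable equations. -/
theorem recursive_estimate_mul_update {l n K : Type*} [Fintype n] [DecidableEq n] [Field K]
    {S : Matrix n n K} (hS : IsUnit S.det) (φ z : n → K) (y : l → K) {c : K}
    (hδ : c + z ⬝ᵥ S⁻¹ *ᵥ φ ≠ 0) (M : Matrix l n K) :
    (M * S⁻¹ + vecMulVec (y - (M * S⁻¹) *ᵥ φ)
        ((1 / (c + z ⬝ᵥ S⁻¹ *ᵥ φ)) • (z ᵥ* S⁻¹))) * (c • S + vecMulVec φ z) =
      c • M + vecMulVec y z := by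
  rw [Matrix.add_mul, vecMulVec_mul, gain_vecMul_update hS φ z hδ, Matrix.mul_add,
    Matrix.mul_smul, nonsing_inv_mul_cancel_right _ _ hS, mul_vecMulVec, sub_vecMulVec]
  abel

/-- A rank-one update with nonzero scaling and nonzero gain denominator is invertible. -/
theorem isUnit_det_smul_add_vecMulVec {n K : Type*} [Fintype n] [DecidableEq n] [Field K]
    {S : Matrix n n K} (hS : IsUnit S.det) (φ z : n → K) {c : K} (hc : c ≠ 0)
    (hδ : c + z ⬝ᵥ S⁻¹ *ᵥ φ ≠ 0) : IsUnit (c • S + vecMulVec φ z).det := by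
  have h := recursive_estimate_mul_update hS φ z 0 hδ (c⁻¹ • (1 : Matrix n n K))
  rw [smul_smul, mul_inv_cancel₀ hc, one_smul, zero_vecMulVec, add_zero] at h
  exact isUnit_det_of_left_inverse h

/-- **One-step recursive instrumental-variable update.**
Let `S_{k-1}` be invertible, `φ, z ∈ ℝ^q`, `y ∈ ℝ^m`, `λ ≠ 0`, and
`δ := λ + zᵀ S_{k-1}⁻¹ φ ≠ 0`. Set `S_k = λ S_{k-1} + φ zᵀ`, `M_k = λ M_{k-1} + y zᵀ`,
`θ_{k-1} = M_{k-1} S_{k-1}⁻¹`, and `hᵀ = zᵀ S_{k-1}⁻¹ / δ`. Then `S_k` is invertible and the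
batch solution `θ_k = M_k S_k⁻¹` obeys the recursive update
`θ_k = θ_{k-1} + (y - θ_{k-1} φ) hᵀ`. -/
theorem recursive_iv_update {q m : ℕ}
    (Sk1 : Matrix (Fin q) (Fin q) ℝ) (hS : IsUnit Sk1.det)
    (φ z : Fin q → ℝ) (y : Fin m → ℝ) (lam : ℝ) (hlam : lam ≠ 0)
    (hδ : lam + z ⬝ᵥ Sk1⁻¹.mulVec φ ≠ 0)
    (Mk1 : Matrix (Fin m) (Fin q) ℝ) :
    IsUnit (lam • Sk1 + Matrix.vecMulVec φ z).det ∧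
    (lam • Mk1 + Matrix.vecMulVec y z) * (lam • Sk1 + Matrix.vecMulVec φ z)⁻¹ =
      Mk1 * Sk1⁻¹ +
        Matrix.vecMulVec (y - (Mk1 * Sk1⁻¹).mulVec φ)
          ((1 / (lam + z ⬝ᵥ Sk1⁻¹.mulVec φ)) • Matrix.vecMul z Sk1⁻¹) := by
  have hunit := isUnit_det_smul_add_vecMulVec hS φ z hlam hδ
  refine ⟨hunit, ?_⟩
  rw [← recursive_estimate_mul_update hS φ z y hδ Mk1, mul_nonsing_inv_cancel_right _ _ hunit]
end
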